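/- Let $1 \le p < q < \infty$ and let $\mu$ be a probability measure on $\mathbb{R}^d$ with finite absolute $q$-moment $M_q(\mu) < \infty$. If $s > d^*_{pq/(q-p)}(\mu)$, then for all sufficiently large $n$, $\inf_{\gamma \in \mathcal{P}(n)} W_p(\mu, \gamma) \le (M_q^p(\mu)+1)^{1/p} n^{-1/s}$. -/

import Mathlib

open MeasureTheory Filter Topology Metric Set
open scoped ENNReal NNReal

noncomputable section

/-! ### ReLU neural networks -/

/-- Forward pass of a ReLU network: `nnForward N M b l x` is the output of the `l`-th hidden
layer (after applying the ReLU) on input `x`. Here `N l` is the number of neurons in layer `l`,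
`M l` and `b l` are the weight matrix and the bias vector of the affine map `A_l`. -/
def nnForward (N : ℕ → ℕ)
    (M : ∀ l : ℕ, Matrix (Fin (N (l + 1))) (Fin (N l)) ℝ)
    (b : ∀ l : ℕ, Fin (N (l + 1)) → ℝ) :
    ∀ l : ℕ, (Fin (N 0) → ℝ) → Fin (N l) → ℝ
  | 0 => fun x => x
  | l + 1 => fun x i => max ((M l).mulVec (nnForward N M b l x) i + b l i) 0

/-- `NNset m d W L` is the set of functions `ℝ^m → ℝ^d` that are representable by ReLU neural
networks with width at most `W` and depth (number of hidden layers) at most `L`. -/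
def NNset (m d W L : ℕ) : Set (EuclideanSpace ℝ (Fin m) → EuclideanSpace ℝ (Fin d)) :=
  {φ | ∃ L' : ℕ, 1 ≤ L' ∧ L' ≤ L ∧
    ∃ (N : ℕ → ℕ) (h0 : N 0 = m) (hL : N (L' + 1) = d),
      (∀ l, 1 ≤ l → l ≤ L' → N l ≤ W) ∧
      ∃ (M : ∀ l : ℕ, Matrix (Fin (N (l + 1))) (Fin (N l)) ℝ)
        (b : ∀ l : ℕ, Fin (N (l + 1)) → ℝ),
        ∀ (x : EuclideanSpace ℝ (Fin m)) (i : Fin d),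
          φ x i = (M L').mulVec (nnForward N M b L' (fun j => x (Fin.cast h0 j)))
              (Fin.cast hL.symm i) + b L' (Fin.cast hL.symm i)}

/-- ReLU networks with one-dimensional input, viewed as functions on `ℝ`. -/
def NNset1 (d W L : ℕ) : Set (ℝ → EuclideanSpace ℝ (Fin d)) :=
  {φ | (fun x : EuclideanSpace ℝ (Fin 1) => φ (x 0)) ∈ NNset 1 d W L}

/-! ### Wasserstein distances -/

/-- `WppENN p μ ν` is the `p`-th power of the `p`-th Wasserstein distance, i.e. the optimal
transportation cost `inf_γ ∫ dist(x,y)^p dγ` over all couplings `γ` of `μ` and `ν`. -/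
def WppENN {E : Type*} [MeasurableSpace E] [PseudoEMetricSpace E] (p : ℝ)
    (μ ν : Measure E) : ℝ≥0∞ :=
  ⨅ (γ : Measure (E × E)) (_ : γ.map Prod.fst = μ ∧ γ.map Prod.snd = ν),
    ∫⁻ z, edist z.1 z.2 ^ p ∂γ

/-- The `p`-th Wasserstein distance `W_p(μ,ν)` (valued in `ℝ≥0∞`). -/
def Wdist {E : Type*} [MeasurableSpace E] [PseudoEMetricSpace E] (p : ℝ)
    (μ ν : Measure E) : ℝ≥0∞ :=
  WppENN p μ ν ^ (1 / p)

/-- `𝒫(n)`: the set of discrete probability measures on `ℝ^d` supported on at most `n` points. -/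
def discreteP (d n : ℕ) : Set (Measure (EuclideanSpace ℝ (Fin d))) :=
  {μ | ∃ (x : Fin n → EuclideanSpace ℝ (Fin d)) (w : Fin n → ℝ≥0∞),
    ∑ i, w i = 1 ∧ μ = ∑ i, w i • Measure.dirac (x i)}

/-- The `q`-th absolute moment `M_q^q(μ) = ∫ |x|^q dμ(x)` (valued in `ℝ≥0∞`). -/
def moment (q : ℝ) {d : ℕ} (μ : Measure (EuclideanSpace ℝ (Fin d))) : ℝ≥0∞ :=
  ∫⁻ x, ENNReal.ofReal ‖x‖ ^ q ∂μ

/-- `M_q(μ) = (∫ |x|^q dμ(x))^{1/q}` as a real number (junk value if the moment is infinite). -/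
def Mq (q : ℝ) {d : ℕ} (μ : Measure (EuclideanSpace ℝ (Fin d))) : ℝ :=
  (moment q μ).toReal ^ (1 / q)

/-! ### Covering numbers and dimensions -/

/-- The `ε`-covering number of a set `S`: the smallest number of open balls of radius `ε`
needed to cover `S` (`⊤` if no finite cover exists). -/
def coveringNumber {E : Type*} [PseudoMetricSpace E] (ε : ℝ) (S : Set E) : ℕ∞ :=
  ⨅ (t : Finset E) (_ : S ⊆ ⋃ x ∈ t, Metric.ball x ε), (t.card : ℕ∞)

/-- The `(ε,δ)`-covering number of a measure `μ`:
`inf { N_ε(S) : μ(S) ≥ 1 - δ }`. -/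
def measureCoveringNumber {E : Type*} [PseudoMetricSpace E] [MeasurableSpace E]
    (ε δ : ℝ) (μ : Measure E) : ℕ∞ :=
  ⨅ (S : Set E) (_ : 1 - ENNReal.ofReal δ ≤ μ S), coveringNumber ε S

/-- Base-2 logarithm of an extended natural number, valued in `ℝ≥0∞`. -/
def elog2 (n : ℕ∞) : ℝ≥0∞ :=
  if n = ⊤ then ⊤ else ENNReal.ofReal (Real.logb 2 (n.toNat : ℝ))

/-- The upper dimension `d_r^*(μ) = limsup_{ε → 0} log₂ N_ε(μ, ε^r) / (-log₂ ε)`. -/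
def upperDim {E : Type*} [PseudoMetricSpace E] [MeasurableSpace E] (r : ℝ)
    (μ : Measure E) : ℝ≥0∞ :=
  Filter.limsup
    (fun ε : ℝ => elog2 (measureCoveringNumber ε (ε ^ r) μ) / ENNReal.ofReal (-Real.logb 2 ε))
    (𝓝[>] (0 : ℝ))

/-- The lower dimension `d_*(μ) = lim_{δ → 0} liminf_{ε → 0} log₂ N_ε(μ,δ) / (-log₂ ε)`;
since the inner quantity is antitone in `δ`, the limit as `δ → 0⁺` equals the supremum over
`δ > 0`. -/
def lowerDim {E : Type*} [PseudoMetricSpace E] [MeasurableSpace E] (μ : Measure E) : ℝ≥0∞ :=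
  ⨆ (δ : ℝ) (_ : 0 < δ),
    Filter.liminf
      (fun ε : ℝ => elog2 (measureCoveringNumber ε δ μ) / ENNReal.ofReal (-Real.logb 2 ε))
      (𝓝[>] (0 : ℝ))

/-- The (upper) Minkowski dimension of a set, via covering numbers. -/
def setDimM {E : Type*} [PseudoMetricSpace E] (S : Set E) : ℝ≥0∞ :=
  Filter.limsup
    (fun ε : ℝ => elog2 (coveringNumber ε S) / ENNReal.ofReal (-Real.logb 2 ε))
    (𝓝[>] (0 : ℝ))

/-- The Minkowski dimension of a measure: `inf { dim_M S : μ(S) = 1 }`. -/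
def measureDimM {E : Type*} [PseudoMetricSpace E] [MeasurableSpace E]
    (μ : Measure E) : ℝ≥0∞ :=
  ⨅ (S : Set E) (_ : μ S = 1), setDimM S

/-- The Hausdorff dimension of a measure: `inf { dim_H S : μ(S) = 1 }`. -/
def measureDimH {E : Type*} [EMetricSpace E] [MeasurableSpace E] (μ : Measure E) : ℝ≥0∞ :=
  ⨅ (S : Set E) (_ : μ S = 1), dimH S

/-- The support of a measure on a metric space: points all of whose balls have positive
measure. -/
def msupport {E : Type*} [PseudoMetricSpace E] [MeasurableSpace E] (μ : Measure E) : Set E :=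
  {x | ∀ ε : ℝ, 0 < ε → 0 < μ (Metric.ball x ε)}

/-! ### f-divergences -/

/-- Conversion `EReal → ℝ≥0∞` (negative values go to `0`). -/
def erealToENNReal (x : EReal) : ℝ≥0∞ :=
  if x = ⊤ then ⊤ else ENNReal.ofReal x.toReal

/-- Integral of an `EReal`-valued function: difference of the lower integrals of the positive
and negative parts. -/
def eintegral {α : Type*} [MeasurableSpace α] (μ : Measure α) (g : α → EReal) : EReal :=
  ((∫⁻ x, erealToENNReal (g x) ∂μ : ℝ≥0∞) : EReal)
    - ((∫⁻ x, erealToENNReal (-(g x)) ∂μ : ℝ≥0∞) : EReal)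

/-- `f(0) := lim_{t ↓ 0} f(t)` (as an `EReal`; realized as a `limsup`, which agrees with the
limit whenever the limit exists, e.g. for convex `f`). -/
def limZero (f : ℝ → ℝ) : EReal :=
  Filter.limsup (fun t : ℝ => ((f t : ℝ) : EReal)) (𝓝[>] (0 : ℝ))

/-- `f^*(0) := lim_{t → ∞} f(t)/t` (as an `EReal`; realized as a `limsup`). -/
def limInfty (f : ℝ → ℝ) : EReal :=
  Filter.limsup (fun t : ℝ => ((f t / t : ℝ) : EReal)) Filter.atTop

/-- The `f`-divergence `D_f(μ ‖ ν)`, defined through the reference measure `τ = μ + ν` with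
densities `p = dμ/dτ`, `q = dν/dτ`:
`D_f(μ‖ν) = ∫_{q > 0} f(p/q) q dτ + f^*(0) μ({q = 0})`,
with the conventions `f(0) = lim_{t↓0} f t` on `{p = 0, q > 0}`. -/
def fDiv (f : ℝ → ℝ) {α : Type*} [MeasurableSpace α] (μ ν : Measure α) : EReal :=
  eintegral ((μ + ν).restrict {x | ν.rnDeriv (μ + ν) x ≠ 0})
    (fun x =>
      if μ.rnDeriv (μ + ν) x = 0 then
        limZero f * (((ν.rnDeriv (μ + ν) x).toReal : ℝ) : EReal)
      else
        ((f ((μ.rnDeriv (μ + ν) x / ν.rnDeriv (μ + ν) x).toReal)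
            * (ν.rnDeriv (μ + ν) x).toReal : ℝ) : EReal))
  + limInfty f * ((μ {x | ν.rnDeriv (μ + ν) x = 0} : ℝ≥0∞) : EReal)

/-! ### Piecewise linear functions -/

/-- The space `𝒮^d(z_0, …, z_{N+1})` of continuous piecewise linear functions `ℝ → ℝ^d` with
breakpoints only at `z_0 < … < z_{N+1}`, constant on `(-∞, z_0)` and `(z_{N+1}, ∞)`. -/
def SpaceS (d N : ℕ) (z : Fin (N + 2) → ℝ) : Set (ℝ → EuclideanSpace ℝ (Fin d)) :=
  {φ | Continuous φ ∧
    (∀ x ≤ z 0, φ x = φ (z 0)) ∧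
    (∀ x, z (Fin.last (N + 1)) ≤ x → φ x = φ (z (Fin.last (N + 1)))) ∧
    (∀ i : Fin (N + 1), ∃ a b : EuclideanSpace ℝ (Fin d),
      ∀ x ∈ Set.Icc (z i.castSucc) (z i.succ), φ x = x • a + b)}

/-- A continuous piecewise linear function `ℝ → ℝ^d`. -/
def IsCPwL {d : ℕ} (φ : ℝ → EuclideanSpace ℝ (Fin d)) : Prop :=
  Continuous φ ∧ ∃ (k : ℕ) (z : Fin (k + 1) → ℝ), Monotone z ∧
    (∃ a b : EuclideanSpace ℝ (Fin d), ∀ x ∈ Set.Iic (z 0), φ x = x • a + b) ∧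
    (∀ i : Fin k, ∃ a b : EuclideanSpace ℝ (Fin d),
      ∀ x ∈ Set.Icc (z i.castSucc) (z i.succ), φ x = x • a + b) ∧
    (∃ a b : EuclideanSpace ℝ (Fin d), ∀ x ∈ Set.Ici (z (Fin.last k)), φ x = x • a + b)

end

/-- The law of a random variable taking values in a list of `n` points belongs to `discreteP d n`. -/
theorem map_comp_mem_discreteP {α : Type*} [MeasurableSpace α] {d n : ℕ} (μ : Measure α)
    [IsProbabilityMeasure μ] {k : α → Fin n} (hk : Measurable k)
    (x : Fin n → EuclideanSpace ℝ (Fin d)) : μ.map (x ∘ k) ∈ discreteP d n := by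
  have hx : Measurable x := measurable_of_finite x
  have hsum : μ.map k = ∑ i, (μ.map k {i}) • Measure.dirac i := by
    rw [← Measure.sum_fintype, Measure.sum_smul_dirac]
  refine ⟨x, fun i => μ.map k {i}, ?_, ?_⟩
  · have : IsProbabilityMeasure (μ.map k) := Measure.isProbabilityMeasure_map hk.aemeasurable
    rw [sum_measure_singleton, Finset.coe_univ, measure_univ]
  · rw [← Measure.map_map hx hk]
    conv_lhs => rw [hsum]
    rw [← Measure.sum_fintype, ← Measure.sum_fintype, Measure.map_sum hx.aemeasurable]
    congr 1
    ext1 i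
    rw [Measure.map_smul, Measure.map_dirac' hx]

/-- The optimal transport cost to an image measure is at most the cost of the transport map. -/
theorem WppENN_map_le {E : Type*} [MeasurableSpace E] [PseudoEMetricSpace E]
    [OpensMeasurableSpace E] [SecondCountableTopology E] (p : ℝ)
    (μ : Measure E) {T : E → E} (hT : Measurable T) :
    WppENN p μ (μ.map T) ≤ ∫⁻ x, edist x (T x) ^ p ∂μ := by
  have hg : Measurable fun x : E => (x, T x) := measurable_id.prodMk hT
  have hcoupling : (μ.map fun x => (x, T x)).map Prod.fst = μ ∧
      (μ.map fun x => (x, T x)).map Prod.snd = μ.map T := by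
    rw [Measure.map_map measurable_fst hg, Measure.map_map measurable_snd hg]
    exact ⟨Measure.map_id, rfl⟩
  rw [← lintegral_map (g := fun x : E => (x, T x)) (measurable_edist.pow_const p) hg]
  exact iInf₂_le (f := fun (γ : Measure (E × E)) (_ : γ.map Prod.fst = μ ∧
    γ.map Prod.snd = μ.map T) => ∫⁻ z, edist z.1 z.2 ^ p ∂γ) _ hcoupling

/-- A finite set of points can be listed after the origin, with a measurable choice of an index
realizing the nearest point. -/
theorem exists_measurable_index_edist_le {d n : ℕ} (t : Finset (EuclideanSpace ℝ (Fin d)))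
    (ht : t.card < n) :
    ∃ (x : Fin n → EuclideanSpace ℝ (Fin d)) (k : EuclideanSpace ℝ (Fin d) → Fin n),
      Measurable k ∧ (∀ z, edist z (x (k z)) ≤ edist z 0) ∧
        ∀ y ∈ t, ∀ z, edist z (x (k z)) ≤ edist z y := by
  obtain ⟨m, rfl⟩ : ∃ m, n = m + 1 := ⟨n - 1, by omega⟩
  let e : ℕ → EuclideanSpace ℝ (Fin d) := fun i => (0 :: t.toList).getD i 0
  have hnear : ∀ j ≤ m, ∀ z, edist z (e (SimpleFunc.nearestPtInd e m z)) ≤ edist z (e j) := by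
    intro j hj z
    have := SimpleFunc.edist_nearestPt_le e z hj
    rwa [edist_comm z, edist_comm z]
  refine ⟨fun i => e i, fun z => ⟨SimpleFunc.nearestPtInd e m z,
    Nat.lt_succ_of_le (SimpleFunc.nearestPtInd_le e m z)⟩, ?_, fun z => ?_, fun y hy z => ?_⟩
  · refine measurable_to_countable' fun i => ?_
    convert (SimpleFunc.nearestPtInd e m).measurableSet_fiber (i : ℕ) using 1
    ext z
    simp [Fin.ext_iff]
  · simpa [e] using hnear 0 (Nat.zero_le m) z
  · obtain ⟨j, hj, rfl⟩ := List.getElem_of_mem (Finset.mem_toList.2 hy)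
    have hjm : j + 1 ≤ m := by
      rw [Finset.length_toList] at hj
      omega
    have hej : e (j + 1) = t.toList[j] := by
      simp [e, List.getElem?_eq_getElem hj]
    exact hej ▸ hnear (j + 1) hjm z

/-- Hölder's inequality on a set: the `p`-th moment on `A` in terms of the `q`-th moment. -/
theorem setLIntegral_rpow_le {α : Type*} [MeasurableSpace α] (μ : Measure α) {f : α → ℝ≥0∞}
    (hf : Measurable f) {p q : ℝ} (hp : 0 < p) (hpq : p < q) (A : Set α) :
    ∫⁻ x in A, f x ^ p ∂μ ≤ (∫⁻ x, f x ^ q ∂μ) ^ (p / q) * μ A ^ ((q - p) / q) := by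
  have hq : 0 < q := hp.trans hpq
  have hqp : 0 < q - p := sub_pos.2 hpq
  have hconj : (q / p).HolderConjugate (q / (q - p)) := by
    rw [Real.holderConjugate_iff]
    refine ⟨(one_lt_div hp).2 hpq, ?_⟩
    field_simp
    ring
  have h := ENNReal.lintegral_mul_le_Lp_mul_Lq (μ.restrict A) hconj
    (hf.pow_const p).aemeasurable (measurable_const (a := (1 : ℝ≥0∞))).aemeasurable
  simp only [Pi.mul_apply, mul_one, ENNReal.one_rpow, lintegral_const, one_mul, one_div_div,
    Measure.restrict_apply_univ, ← ENNReal.rpow_mul, mul_div_cancel₀ q hp.ne'] at h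
  refine h.trans ?_
  gcongr
  exact Measure.restrict_le_self

/-- Quantization bound from a cover of most of the mass by balls of radius `ε`. -/
theorem exists_mem_discreteP_Wdist_le {p q : ℝ} {d n : ℕ} (hp : 1 ≤ p) (hpq : p < q)
    (μ : Measure (EuclideanSpace ℝ (Fin d))) [IsProbabilityMeasure μ]
    (hM : moment q μ ≠ ⊤) {ε : ℝ} (hε : 0 < ε) {S : Set (EuclideanSpace ℝ (Fin d))}
    (hS : 1 - ENNReal.ofReal (ε ^ (p * q / (q - p))) ≤ μ S)
    (t : Finset (EuclideanSpace ℝ (Fin d))) (hSt : S ⊆ ⋃ x ∈ t, Metric.ball x ε)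
    (ht : t.card < n) :
    ∃ γ ∈ discreteP d n,
      Wdist p μ γ ≤ ENNReal.ofReal ((Mq q μ ^ p + 1) ^ (1 / p) * ε) := by
  have hp0 : 0 < p := zero_lt_one.trans_le hp
  have hq0 : 0 < q := hp0.trans hpq
  have hqp : 0 < q - p := sub_pos.2 hpq
  obtain ⟨x, k, hk, hk0, hkt⟩ := exists_measurable_index_edist_le t ht
  refine ⟨μ.map (x ∘ k), map_comp_mem_discreteP μ hk x, ?_⟩
  set U := ⋃ x ∈ t, Metric.ball x ε with hU
  have hUo : MeasurableSet U := (isOpen_biUnion fun _ _ => Metric.isOpen_ball).measurableSet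
  have hin : ∫⁻ z in U, edist z ((x ∘ k) z) ^ p ∂μ ≤ ENNReal.ofReal (ε ^ p) := by
    calc ∫⁻ z in U, edist z ((x ∘ k) z) ^ p ∂μ
        ≤ ∫⁻ _ in U, ENNReal.ofReal (ε ^ p) ∂μ := by
          refine setLIntegral_mono measurable_const fun z hz => ?_
          obtain ⟨y, hy, hzy⟩ := mem_iUnion₂.1 hz
          rw [← ENNReal.ofReal_rpow_of_pos hε]
          refine ENNReal.rpow_le_rpow ((hkt y hy z).trans ?_) hp0.le
          rw [edist_dist]
          exact ENNReal.ofReal_le_ofReal (Metric.mem_ball.1 hzy).le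
      _ ≤ ENNReal.ofReal (ε ^ p) := by
          rw [setLIntegral_const]
          exact mul_le_of_le_one_right' prob_le_one
  have hUc : μ Uᶜ ≤ ENNReal.ofReal (ε ^ (p * q / (q - p))) := by
    rw [prob_compl_eq_one_sub hUo, tsub_le_iff_left, ← tsub_le_iff_right]
    exact hS.trans (measure_mono hSt)
  have hout : ∫⁻ z in Uᶜ, edist z ((x ∘ k) z) ^ p ∂μ ≤
      ENNReal.ofReal (Mq q μ ^ p * ε ^ p) := by
    calc ∫⁻ z in Uᶜ, edist z ((x ∘ k) z) ^ p ∂μ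
        ≤ ∫⁻ z in Uᶜ, ENNReal.ofReal ‖z‖ ^ p ∂μ := by
          refine lintegral_mono fun z => ENNReal.rpow_le_rpow ?_ hp0.le
          simpa [edist_dist] using hk0 z
      _ ≤ moment q μ ^ (p / q) * μ Uᶜ ^ ((q - p) / q) :=
          setLIntegral_rpow_le μ (by fun_prop) hp0 hpq _
      _ ≤ moment q μ ^ (p / q) * ENNReal.ofReal (ε ^ (p * q / (q - p))) ^ ((q - p) / q) := by
          gcongr
      _ = ENNReal.ofReal (Mq q μ ^ p * ε ^ p) := by
          rw [ENNReal.ofReal_rpow_of_pos (by positivity), ← Real.rpow_mul hε.le,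
            show p * q / (q - p) * ((q - p) / q) = p by field_simp,
            ENNReal.ofReal_mul (by unfold Mq; positivity), Mq,
            ← Real.rpow_mul ENNReal.toReal_nonneg, one_div_mul_eq_div,
            ← ENNReal.ofReal_rpow_of_nonneg ENNReal.toReal_nonneg (by positivity),
            ENNReal.ofReal_toReal hM]
  have hMq : 0 ≤ Mq q μ := by unfold Mq; positivity
  have hcost : WppENN p μ (μ.map (x ∘ k)) ≤ ENNReal.ofReal ((Mq q μ ^ p + 1) * ε ^ p) := by
    refine (WppENN_map_le p μ ((measurable_of_finite x).comp hk)).trans ?_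
    rw [← lintegral_add_compl _ hUo, add_mul, one_mul, add_comm (_ * _),
      ENNReal.ofReal_add (by positivity) (by positivity)]
    exact add_le_add hin hout
  refine (ENNReal.rpow_le_rpow hcost (by positivity : 0 ≤ 1 / p)).trans_eq ?_
  rw [ENNReal.ofReal_rpow_of_nonneg (by positivity) (by positivity),
    Real.mul_rpow (by positivity) (by positivity), ← Real.rpow_mul hε.le,
    mul_one_div_cancel hp0.ne', Real.rpow_one]

/-- A bound on the logarithm of an extended natural number at scale `ε = n ^ (-1 / s)`. -/
theorem lt_natCast_of_elog2_div_lt {N : ℕ∞} {n : ℕ} (hn : 1 < n) {s : ℝ} (hs : 0 < s)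
    (h : elog2 N / ENNReal.ofReal (-Real.logb 2 ((n : ℝ) ^ (-1 / s))) < ENNReal.ofReal s) :
    N < n := by
  have hn1 : (1 : ℝ) < n := by exact_mod_cast hn
  have hlog : 0 < Real.logb 2 n := Real.logb_pos one_lt_two hn1
  have hL : -Real.logb 2 ((n : ℝ) ^ (-1 / s)) = Real.logb 2 n / s := by
    rw [Real.logb_rpow_eq_mul_logb_of_pos (by positivity)]
    ring
  have hLpos : 0 < Real.logb 2 n / s := div_pos hlog hs
  rw [hL, ENNReal.div_lt_iff (Or.inl (ENNReal.ofReal_pos.2 hLpos).ne')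
    (Or.inl ENNReal.ofReal_ne_top), ← ENNReal.ofReal_mul hs.le, mul_div_cancel₀ _ hs.ne'] at h
  induction N with
  | top => simp [elog2] at h
  | coe N =>
    rw [elog2, if_neg (ENat.natCast_ne_top N), ENat.toNat_natCast, ENNReal.ofReal_lt_ofReal_iff hlog] at h
    rcases Nat.eq_zero_or_pos N with rfl | hN
    · exact_mod_cast zero_lt_one.trans hn
    · have : (N : ℝ) < n :=
        (Real.logb_lt_logb_iff one_lt_two (by exact_mod_cast hN) (by positivity)).1 h
      exact_mod_cast this

/-- Theorem, upper bound: approximation by discrete distributions in terms of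
the upper dimension. -/
theorem statement10 (p q : ℝ) (d : ℕ) (hd : 0 < d) (hp : 1 ≤ p) (hpq : p < q)
    (μ : Measure (EuclideanSpace ℝ (Fin d))) [IsProbabilityMeasure μ]
    (hM : moment q μ ≠ ⊤) (s : ℝ)
    (hs : upperDim (p * q / (q - p)) μ < ENNReal.ofReal s) :
    ∃ n₀ : ℕ, ∀ n ≥ n₀,
      (⨅ γ ∈ discreteP d n, Wdist p μ γ) ≤
        ENNReal.ofReal ((Mq q μ ^ p + 1) ^ (1 / p) * (n : ℝ) ^ (-1 / s)) := by
  have hs0 : 0 < s := ENNReal.ofReal_pos.1 (bot_le.trans_lt hs)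
  have hlim : Tendsto (fun n : ℕ => (n : ℝ) ^ (-1 / s)) atTop (𝓝[>] 0) := by
    refine tendsto_nhdsWithin_iff.2 ⟨?_, ?_⟩
    · rw [neg_div]
      exact (tendsto_rpow_neg_atTop (by positivity)).comp tendsto_natCast_atTop_atTop
    · filter_upwards [eventually_gt_atTop 0] with n hn
      exact Real.rpow_pos_of_pos (by exact_mod_cast hn) _
  have hev := (hlim.eventually (eventually_lt_of_limsup_lt hs)).and (eventually_gt_atTop 1)
  obtain ⟨n₀, hn₀⟩ := eventually_atTop.1 hev
  refine ⟨n₀, fun n hn => ?_⟩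
  obtain ⟨hlt, hn1⟩ := hn₀ n hn
  have hε : 0 < (n : ℝ) ^ (-1 / s) :=
    Real.rpow_pos_of_pos (by exact_mod_cast zero_lt_one.trans hn1) _
  have hN := lt_natCast_of_elog2_div_lt hn1 hs0 hlt
  simp only [measureCoveringNumber, _root_.coveringNumber, iInf_lt_iff] at hN
  obtain ⟨S, hS, t, hSt, ht⟩ := hN
  obtain ⟨γ, hγ, hle⟩ := exists_mem_discreteP_Wdist_le hp hpq μ hM hε hS t hSt
    (by exact_mod_cast ht)
  exact (iInf₂_le γ hγ).trans hle
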